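/- arXiv:math/0009047 — 6 statements merged into one kernel-verified Lean document; each statement's English description precedes it below -/
import Mathlib

section
/- Every subset S ⊆ X with S ∉ I contains a nonempty set of the form B_s \ Z for some pattern s and some Z ∈ I; in particular, every subset of X not belonging to I contains a nonempty τ-open set. -/
open Set TopologicalSpace

/-- `I` is a σ-ideal of subsets of `X`: it contains `∅`, is closed under taking
subsets and under countable unions. -/
def IsSigmaIdeal {X : Type*} (I : Set (Set X)) : Prop :=
  ∅ ∈ I ∧ (∀ S T : Set X, S ⊆ T → T ∈ I → S ∈ I) ∧
    ∀ f : ℕ → Set X, (∀ n, f n ∈ I) → (⋃ n, f n) ∈ I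

/-- The set `B_s` associated to the pattern with (finite) domain `D` and values `s`:
`B_s = ⋂_{α ∈ D} A_α^{s α}` where `A^1 = A` and `A^0 = X \ A`. -/
def patternSet {X J : Type*} (A : J → Set X) (D : Finset J) (s : J → Bool) : Set X :=
  ⋂ α ∈ D, if s α then A α else (A α)ᶜ

/-- Two patterns are contradictory if they disagree at some common point of their domains. -/
def Contradictory {J : Type*} (p q : Finset J × (J → Bool)) : Prop :=
  ∃ α, α ∈ p.1 ∧ α ∈ q.1 ∧ p.2 α ≠ q.2 α

/-- Independence mod `I`: `B_s ∉ I` for every pattern `s`. -/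
def IndependentModI {X J : Type*} (I : Set (Set X)) (A : J → Set X) : Prop :=
  ∀ (D : Finset J) (s : J → Bool), patternSet A D s ∉ I

/-- Decomposition: every `S ⊆ X` agrees mod `I` with a countable union of `B_s`'s for
pairwise contradictory patterns. -/
def Decomposition {X J : Type*} (I : Set (Set X)) (A : J → Set X) : Prop :=
  ∀ S : Set X, ∃ P : Set (Finset J × (J → Bool)), P.Countable ∧
    P.Pairwise Contradictory ∧ symmDiff S (⋃ p ∈ P, patternSet A p.1 p.2) ∈ I

/-- Separation: disjoint members of `I` are separated by some `A_α`. -/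
def SeparatesIdeal {X J : Type*} (I : Set (Set X)) (A : J → Set X) : Prop :=
  ∀ Z ∈ I, ∀ Z' ∈ I, Disjoint Z Z' → ∃ α, Z ⊆ A α ∧ Z' ⊆ (A α)ᶜ

/-- The topology `τ` generated by the subbasis
`{A_α \ Z : α ∈ J, Z ∈ I} ∪ {(X \ A_α) \ Z : α ∈ J, Z ∈ I}`. -/
def idealTopology {X J : Type*} (I : Set (Set X)) (A : J → Set X) : TopologicalSpace X :=
  TopologicalSpace.generateFrom
    ({U | ∃ α, ∃ Z ∈ I, U = A α \ Z} ∪ {U | ∃ α, ∃ Z ∈ I, U = (A α)ᶜ \ Z})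

theorem isOpen_signed_diff {X J : Type*} {I : Set (Set X)} {A : J → Set X} (α : J) (b : Bool)
    {Z : Set X} (hZ : Z ∈ I) :
    @IsOpen X (idealTopology I A) ((if b then A α else (A α)ᶜ) \ Z) := by
  cases b
  · exact isOpen_generateFrom_of_mem (Or.inr ⟨α, Z, hZ, by simp⟩)
  · exact isOpen_generateFrom_of_mem (Or.inl ⟨α, Z, hZ, by simp⟩)

theorem isOpen_compl_of_mem_ideal {X J : Type*} [Nonempty J] {I : Set (Set X)} {A : J → Set X}
    {Z : Set X} (hZ : Z ∈ I) : @IsOpen X (idealTopology I A) Zᶜ := by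
  obtain ⟨α⟩ := ‹Nonempty J›
  have h := @IsOpen.union X _ _ (idealTopology I A)
    (isOpen_signed_diff (A := A) α true hZ) (isOpen_signed_diff (A := A) α false hZ)
  simpa [← union_sdiff_distrib, compl_eq_univ_sdiff] using h

theorem isOpen_patternSet_diff {X J : Type*} [Nonempty J] {I : Set (Set X)} {A : J → Set X}
    (h_empty : ∅ ∈ I) (D : Finset J) (s : J → Bool) {Z : Set X} (hZ : Z ∈ I) :
    @IsOpen X (idealTopology I A) (patternSet A D s \ Z) := by
  let _ : TopologicalSpace X := idealTopology I A
  refine IsOpen.inter (isOpen_biInter_finset fun α _ => ?_) (isOpen_compl_of_mem_ideal hZ)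
  simpa using isOpen_signed_diff (A := A) α (s α) h_empty

theorem Decomposition.exists_patternSet_diff_mem {X J : Type*} {I : Set (Set X)} {A : J → Set X}
    (hdec : Decomposition I A) (h_down : ∀ S T : Set X, S ⊆ T → T ∈ I → S ∈ I)
    {S : Set X} (hS : S ∉ I) :
    ∃ (D : Finset J) (s : J → Bool), patternSet A D s \ S ∈ I := by
  obtain ⟨P, -, -, hP⟩ := hdec S
  obtain rfl | ⟨p, hp⟩ := P.eq_empty_or_nonempty
  · exact absurd (by simpa [symmDiff_def] using hP) hS
  · refine ⟨p.1, p.2, h_down _ _ ?_ hP⟩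
    rintro x ⟨hx, hxS⟩
    exact Or.inr ⟨mem_biUnion hp hx, hxS⟩

theorem stmt_3 {X J : Type*} (I : Set (Set X)) (A : J → Set X)
    (hI : IsSigmaIdeal I) (hX : (Set.univ : Set X) ∉ I) (hsing : ∀ x : X, ({x} : Set X) ∈ I)
    (hind : IndependentModI I A) (hdec : Decomposition I A) (hsep : SeparatesIdeal I A)
    : ∀ S : Set X, S ∉ I →
      (∃ (D : Finset J) (s : J → Bool), ∃ Z ∈ I,
        (patternSet A D s \ Z).Nonempty ∧ patternSet A D s \ Z ⊆ S) ∧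
      ∃ U : Set X, @IsOpen X (idealTopology I A) U ∧ U.Nonempty ∧ U ⊆ S := by
  intro S hS
  obtain ⟨h_empty, h_down, -⟩ := hI
  have : Nonempty J :=
    let ⟨α, _⟩ := hsep ∅ h_empty ∅ h_empty disjoint_bot_left
    ⟨α⟩
  obtain ⟨D, s, hZ⟩ := hdec.exists_patternSet_diff_mem h_down hS
  have h_ne : (patternSet A D s \ (patternSet A D s \ S)).Nonempty := by
    rw [nonempty_iff_ne_empty, Ne, sdiff_eq_empty]
    exact fun h => hind D s (h_down _ _ h hZ)
  have h_sub : patternSet A D s \ (patternSet A D s \ S) ⊆ S := by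
    rw [sdiff_sdiff_right_self]
    exact inter_subset_right
  exact ⟨⟨D, s, _, hZ, h_ne, h_sub⟩, _, isOpen_patternSet_diff h_empty D s hZ, h_ne, h_sub⟩
end

section
/- Every set Z ∈ I is nowhere dense in (X, τ), that is, the interior of the τ-closure of Z is empty; consequently every member of I is meager in (X, τ). -/
open Set TopologicalSpace

theorem IsSigmaIdeal.union_mem {X : Type*} {I : Set (Set X)} (hI : IsSigmaIdeal I)
    {S T : Set X} (hS : S ∈ I) (hT : T ∈ I) : S ∪ T ∈ I := by
  refine hI.2.1 _ _ ?_ (hI.2.2 (fun n => if n = 0 then S else T) fun n => ?_)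
  · rintro x (hx | hx)
    · exact mem_iUnion.2 ⟨0, by simpa using hx⟩
    · exact mem_iUnion.2 ⟨1, by simpa using hx⟩
  · split_ifs <;> assumption

theorem mem_patternSet_iff {X J : Type*} {A : J → Set X} {D : Finset J} {s : J → Bool} {x : X} :
    x ∈ patternSet A D s ↔ ∀ α ∈ D, (x ∈ A α ↔ s α = true) := by
  simp only [patternSet, mem_iInter]
  refine forall₂_congr fun α _ => ?_
  cases s α <;> simp

open Classical Topology in
/-- Every neighbourhood of `x` contains, up to a member of `I`, the set of points with the
same finite pattern as `x`. -/
theorem exists_patternSet_diff_subset {X J : Type*} {I : Set (Set X)} {A : J → Set X}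
    (hI : IsSigmaIdeal I) {U : Set X} (hU : IsOpen[idealTopology I A] U) :
    ∀ x ∈ U, ∃ D : Finset J, ∃ W ∈ I, patternSet A D (fun α => decide (x ∈ A α)) \ W ⊆ U := by
  induction hU with
  | basic V hV =>
    intro x hx
    rcases hV with ⟨α, W, hW, rfl⟩ | ⟨α, W, hW, rfl⟩ <;>
    · refine ⟨{α}, W, hW, fun y hy => ⟨?_, hy.2⟩⟩
      have h := mem_patternSet_iff.1 hy.1 α (Finset.mem_singleton_self α)
      have hxα := hx.1
      simp_all
  | univ => exact fun x _ => ⟨∅, ∅, hI.1, subset_univ _⟩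
  | inter U V _ _ ihU ihV =>
    intro x hx
    obtain ⟨D, W, hW, hDU⟩ := ihU x hx.1
    obtain ⟨E, W', hW', hEV⟩ := ihV x hx.2
    refine ⟨D ∪ E, W ∪ W', hI.union_mem hW hW', fun y hy => ⟨hDU ⟨?_, fun h => hy.2 (.inl h)⟩,
      hEV ⟨?_, fun h => hy.2 (.inr h)⟩⟩⟩
    · exact mem_patternSet_iff.2 fun α hα =>
        mem_patternSet_iff.1 hy.1 α (Finset.mem_union_left _ hα)
    · exact mem_patternSet_iff.2 fun α hα =>
        mem_patternSet_iff.1 hy.1 α (Finset.mem_union_right _ hα)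
  | sUnion S _ ih =>
    rintro x ⟨V, hV, hx⟩
    obtain ⟨D, W, hW, h⟩ := ih V hV x hx
    exact ⟨D, W, hW, h.trans (subset_sUnion_of_mem hV)⟩

open Topology in
theorem eq_empty_of_isOpen_of_mem_ideal {X J : Type*} {I : Set (Set X)} {A : J → Set X}
    (hI : IsSigmaIdeal I) (hind : IndependentModI I A) {U : Set X}
    (hU : IsOpen[idealTopology I A] U) (hUI : U ∈ I) : U = ∅ := by
  refine eq_empty_of_forall_notMem fun x hx => ?_
  obtain ⟨D, W, hW, h⟩ := exists_patternSet_diff_subset hI hU x hx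
  exact hind D _ (hI.2.1 _ _ (sdiff_subset_iff.1 h) (hI.union_mem hW hUI))

open Topology in
theorem isClosed_of_mem_ideal {X J : Type*} [Nonempty J] {I : Set (Set X)} (A : J → Set X)
    {Z : Set X} (hZ : Z ∈ I) : IsClosed[idealTopology I A] Z := by
  let α := Classical.arbitrary J
  let := idealTopology I A
  have h : IsOpen (A α \ Z ∪ (A α)ᶜ \ Z) :=
    IsOpen.union (.basic _ (.inl ⟨α, Z, hZ, rfl⟩)) (.basic _ (.inr ⟨α, Z, hZ, rfl⟩))
  rw [← union_sdiff_distrib, union_compl_self, ← compl_eq_univ_sdiff] at h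
  exact isOpen_compl_iff.1 h

theorem stmt_4 {X J : Type*} (I : Set (Set X)) (A : J → Set X)
    (hI : IsSigmaIdeal I) (hX : (Set.univ : Set X) ∉ I) (hsing : ∀ x : X, ({x} : Set X) ∈ I)
    (hind : IndependentModI I A) (hdec : Decomposition I A) (hsep : SeparatesIdeal I A)
    : ∀ Z ∈ I, @IsNowhereDense X (idealTopology I A) Z ∧ @IsMeagre X (idealTopology I A) Z := by
  intro Z hZ
  obtain ⟨α, -⟩ := hsep ∅ hI.1 ∅ hI.1 disjoint_bot_left
  have : Nonempty J := ⟨α⟩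
  let := idealTopology I A
  have hnd : IsNowhereDense Z := (isClosed_of_mem_ideal A hZ).isNowhereDense_iff.2
    (eq_empty_of_isOpen_of_mem_ideal hI hind isOpen_interior
      (hI.2.1 _ _ interior_subset hZ))
  exact ⟨hnd, hnd.isMeagre⟩
end

section
/- Every subset of X is the union of a τ-open set and a τ-closed set. -/
open Set TopologicalSpace

theorem isClosed_idealTopology_of_mem {X J : Type*} [Nonempty J] {I : Set (Set X)} (A : J → Set X)
    {Z : Set X} (hZ : Z ∈ I) : @IsClosed X (idealTopology I A) Z := by
  let _ := idealTopology I A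
  obtain ⟨α⟩ := ‹Nonempty J›
  have h : Zᶜ = A α \ Z ∪ (A α)ᶜ \ Z := by
    rw [← union_sdiff_distrib, union_compl_self, compl_eq_univ_sdiff]
  rw [← isOpen_compl_iff, h]
  exact (isOpen_generateFrom_of_mem (Or.inl ⟨α, Z, hZ, rfl⟩)).union
    (isOpen_generateFrom_of_mem (Or.inr ⟨α, Z, hZ, rfl⟩))

theorem isOpen_idealTopology_patternSet {X J : Type*} {I : Set (Set X)} (A : J → Set X)
    (hI : ∅ ∈ I) (D : Finset J) (s : J → Bool) :
    @IsOpen X (idealTopology I A) (patternSet A D s) := by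
  let _ := idealTopology I A
  refine isOpen_biInter_finset fun α _ => ?_
  split
  · exact isOpen_generateFrom_of_mem (Or.inl ⟨α, ∅, hI, sdiff_empty.symm⟩)
  · exact isOpen_generateFrom_of_mem (Or.inr ⟨α, ∅, hI, sdiff_empty.symm⟩)

theorem stmt_6 {X J : Type*} (I : Set (Set X)) (A : J → Set X)
    (hI : IsSigmaIdeal I) (hX : (Set.univ : Set X) ∉ I) (hsing : ∀ x : X, ({x} : Set X) ∈ I)
    (hind : IndependentModI I A) (hdec : Decomposition I A) (hsep : SeparatesIdeal I A)
    : ∀ S : Set X, ∃ U F : Set X,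
      @IsOpen X (idealTopology I A) U ∧ @IsClosed X (idealTopology I A) F ∧ S = U ∪ F := by
  intro S
  let _ := idealTopology I A
  obtain ⟨α, -⟩ := hsep ∅ hI.1 ∅ hI.1 (disjoint_empty _)
  have : Nonempty J := ⟨α⟩
  obtain ⟨P, -, -, hP⟩ := hdec S
  set G := ⋃ p ∈ P, patternSet A p.1 p.2
  have hG : IsOpen G := isOpen_biUnion fun p _ => isOpen_idealTopology_patternSet A hI.1 p.1 p.2
  refine ⟨G \ symmDiff S G, S \ G, hG.sdiff (isClosed_idealTopology_of_mem A hP),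
    isClosed_idealTopology_of_mem A (hI.2.1 _ _ subset_union_left hP), ?_⟩
  ext x
  simp only [mem_union, mem_sdiff, mem_symmDiff]
  tauto
end

section
/- In any topological space, the union of a family of pairwise disjoint open meager sets is meager. -/
/-- A meagre set is covered by a sequence of nowhere dense sets. -/
theorem IsMeagre.exists_seq_isNowhereDense {X : Type*} [TopologicalSpace X] {s : Set X}
    (hs : IsMeagre s) :
    ∃ f : ℕ → Set X, (∀ n, IsNowhereDense (f n)) ∧ s ⊆ ⋃ n, f n := by
  obtain ⟨S, hS, hc, hsub⟩ := isMeagre_iff_countable_union_isNowhereDense.1 hs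
  rcases S.eq_empty_or_nonempty with rfl | hne
  · exact ⟨fun _ => ∅, fun _ => isNowhereDense_empty, hsub.trans (by simp)⟩
  · obtain ⟨f, rfl⟩ := hc.exists_eq_range hne
    exact ⟨f, fun n => hS _ ⟨n, rfl⟩, by rwa [Set.sUnion_range] at hsub⟩

/-- If nowhere dense sets are cut down to pairwise disjoint open sets, their union is
nowhere dense. -/
theorem isNowhereDense_biUnion_inter_of_pairwise_disjoint {X : Type*} [TopologicalSpace X]
    {𝒢 : Set (Set X)} (hopen : ∀ G ∈ 𝒢, IsOpen G) (hdisj : 𝒢.Pairwise Disjoint)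
    {f : Set X → Set X} (hf : ∀ G ∈ 𝒢, IsNowhereDense (f G)) :
    IsNowhereDense (⋃ G ∈ 𝒢, G ∩ f G) := by
  set A := ⋃ G ∈ 𝒢, G ∩ f G
  refine Set.eq_empty_iff_forall_notMem.2 fun x hx => ?_
  obtain ⟨y, hyU, hyA⟩ := mem_closure_iff.1 (interior_subset hx) _ isOpen_interior hx
  obtain ⟨G, hG, hyG, -⟩ := Set.mem_iUnion₂.1 hyA
  have hGA : G ∩ A ⊆ f G := by
    rintro z ⟨hzG, hzA⟩
    obtain ⟨H, hH, hzH, hzf⟩ := Set.mem_iUnion₂.1 hzA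
    obtain rfl : G = H := hdisj.eq hG hH (Set.not_disjoint_iff.2 ⟨z, hzG, hzH⟩)
    exact hzf
  have hsub : G ∩ interior (closure A) ⊆ closure (f G) :=
    (Set.inter_subset_inter_right G interior_subset).trans
      ((hopen G hG).inter_closure.trans (closure_mono hGA))
  have hy : y ∈ interior (closure (f G)) :=
    interior_maximal hsub ((hopen G hG).inter isOpen_interior) ⟨hyG, hyU⟩
  rwa [hf G hG] at hy

/-- In any topological space, the union of a family of pairwise disjoint open meager
sets is meager. -/
theorem stmt_13 {X : Type*} [TopologicalSpace X] (𝒢 : Set (Set X))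
    (hopen : ∀ G ∈ 𝒢, IsOpen G) (hmeagre : ∀ G ∈ 𝒢, IsMeagre G)
    (hdisj : 𝒢.Pairwise Disjoint) :
    IsMeagre (⋃₀ 𝒢) := by
  choose! f hf hcov using fun G hG => (hmeagre G hG).exists_seq_isNowhereDense
  refine (isMeagre_iUnion fun n => (isNowhereDense_biUnion_inter_of_pairwise_disjoint hopen hdisj
    (f := fun G => f G n) fun G hG => hf G hG n).isMeagre).mono ?_
  rintro x ⟨G, hG, hxG⟩
  obtain ⟨n, hn⟩ := Set.mem_iUnion.1 (hcov G hG hxG)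
  exact Set.mem_iUnion.2 ⟨n, Set.mem_iUnion₂.2 ⟨G, hG, hxG, hn⟩⟩
end

section
/- Let X be a topological space in which no nonempty open set is meager, and let W be a family of nonempty open subsets of X such that the intersection of any two distinct members of W is meager, and which is maximal (with respect to inclusion) among families with these properties. Then X \ ⋃W is nowhere dense; in particular it is meager. -/
/-- `W` is a family of nonempty open sets with pairwise meager intersections which is
maximal (w.r.t. inclusion) among such families. -/
def MaximalOpenAlmostDisjoint {X : Type*} [TopologicalSpace X] (W : Set (Set X)) : Prop :=
  (∀ G ∈ W, IsOpen G ∧ G.Nonempty) ∧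
  (∀ G ∈ W, ∀ G' ∈ W, G ≠ G' → IsMeagre (G ∩ G')) ∧
  ∀ W' : Set (Set X), W ⊆ W' →
    (∀ G ∈ W', IsOpen G ∧ G.Nonempty) →
    (∀ G ∈ W', ∀ G'2 ∈ W', G ≠ G'2 → IsMeagre (G ∩ G'2)) → W' = W

/-- If no nonempty open set is meager and `W` is a maximal family of nonempty open
sets with pairwise meager intersections, then `X \ ⋃W` is nowhere dense, hence meager. -/
theorem stmt_16 {X : Type*} [TopologicalSpace X]
    (h : ∀ U : Set X, IsOpen U → U.Nonempty → ¬ IsMeagre U)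
    (W : Set (Set X)) (hW : MaximalOpenAlmostDisjoint W) :
    IsNowhereDense ((⋃₀ W)ᶜ) ∧ IsMeagre ((⋃₀ W)ᶜ) := by
  have hclosed : IsClosed (⋃₀ W)ᶜ := (isOpen_sUnion fun G hG => (hW.1 G hG).1).isClosed_compl
  suffices hnd : IsNowhereDense (⋃₀ W)ᶜ from ⟨hnd, hnd.isMeagre⟩
  obtain ⟨hopen, hmeagre, hmax⟩ := hW
  rw [hclosed.isNowhereDense_iff]
  by_contra hne
  set U := interior (⋃₀ W)ᶜ
  have hUne : U.Nonempty := Set.nonempty_iff_ne_empty.mpr hne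
  have hdisj : ∀ G ∈ W, U ∩ G = ∅ := fun G hG =>
    Set.disjoint_iff_inter_eq_empty.mp <|
      (Set.disjoint_compl_left_iff_subset.mpr (Set.subset_sUnion_of_mem hG)).mono_left
        interior_subset
  have hins : insert U W = W := by
    refine hmax _ (Set.subset_insert U W) ?_ ?_
    · rintro G (rfl | hG)
      · exact ⟨isOpen_interior, hUne⟩
      · exact hopen G hG
    · rintro G (rfl | hG) G' (rfl | hG') hGG'
      · exact absurd rfl hGG'
      · rw [hdisj G' hG']
        exact IsMeagre.empty
      · rw [Set.inter_comm, hdisj G hG]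
        exact IsMeagre.empty
      · exact hmeagre G hG G' hG' hGG'
  have hUU := hdisj U (hins ▸ Set.mem_insert U W)
  rw [Set.inter_self] at hUU
  exact hne hUU
end

section
/- Let X be a topological space that is non-meager in itself and in which no nonempty open set is meager. For each n ∈ ℕ, let W_n be a family of nonempty open subsets of X such that the intersection of any two distinct members of W_n is meager, and which is maximal (with respect to inclusion) among families with these properties. Then there exist a point x ∈ X and sets A_n ∈ W_n (for each n ∈ ℕ) with x ∈ A_n for every n; in particular ⋂_{n ∈ ℕ} A_n ≠ ∅. -/
theorem MaximalOpenAlmostDisjoint.isOpen_sUnion {X : Type*} [TopologicalSpace X]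
    {W : Set (Set X)} (hW : MaximalOpenAlmostDisjoint W) : IsOpen (⋃₀ W) :=
  _root_.isOpen_sUnion fun G hG => (hW.1 G hG).1

theorem MaximalOpenAlmostDisjoint.dense_sUnion {X : Type*} [TopologicalSpace X]
    {W : Set (Set X)} (hW : MaximalOpenAlmostDisjoint W) : Dense (⋃₀ W) := by
  obtain ⟨hopen, hmeagre, hmax⟩ := hW
  refine dense_iff_inter_open.2 fun U hU hne => ?_
  by_contra hdisj
  have hempty : ∀ G ∈ W, U ∩ G = ∅ := fun G hG =>
    Set.eq_empty_of_forall_notMem fun y hy => hdisj ⟨y, hy.1, G, hG, hy.2⟩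
  have hins : insert U W = W := by
    refine hmax _ (Set.subset_insert U W) ?_ ?_
    · rintro G (rfl | hG)
      exacts [⟨hU, hne⟩, hopen G hG]
    · rintro G (rfl | hG) G' (rfl | hG') hGG'
      · exact absurd rfl hGG'
      · rw [hempty G' hG']
        exact IsMeagre.empty
      · rw [Set.inter_comm, hempty G hG]
        exact IsMeagre.empty
      · exact hmeagre G hG G' hG' hGG'
  have hUW : U ∈ W := hins ▸ Set.mem_insert U W
  have hUU := hempty U hUW
  rw [Set.inter_self] at hUU
  exact hne.ne_empty hUU

/-- If `X` is non-meager in itself, no nonempty open set is meager, and each `W n` is a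
maximal family of nonempty open sets with pairwise meager intersections, then one can
choose `A n ∈ W n` with a common point; in particular `⋂ n, A n ≠ ∅`. -/
theorem stmt_17 {X : Type*} [TopologicalSpace X]
    (hX : ¬ IsMeagre (Set.univ : Set X))
    (h : ∀ U : Set X, IsOpen U → U.Nonempty → ¬ IsMeagre U)
    (W : ℕ → Set (Set X)) (hW : ∀ n, MaximalOpenAlmostDisjoint (W n)) :
    ∃ (x : X) (A : ℕ → Set X), (∀ n, A n ∈ W n) ∧ (∀ n, x ∈ A n) ∧
      (⋂ n, A n).Nonempty := by
  have hres : (⋂ n, ⋃₀ W n) ∈ residual X := countable_iInter_mem.2 fun n =>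
    residual_of_dense_open (hW n).isOpen_sUnion (hW n).dense_sUnion
  have hne : (⋂ n, ⋃₀ W n).Nonempty := by
    refine Set.nonempty_iff_ne_empty.2 fun he => hX ?_
    rw [IsMeagre, Set.compl_univ, ← he]
    exact hres
  obtain ⟨x, hx⟩ := hne
  choose A hA hxA using fun n => Set.mem_iInter.1 hx n
  exact ⟨x, A, hA, hxA, x, Set.mem_iInter.2 hxA⟩
end
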